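/- arXiv:2012.04299 — 8 statements merged into one kernel-verified Lean document; each statement's English description precedes it below -/
import Mathlib

section
/- Let a, b, c, h be real numbers with a ≠ 0. Then there exist real numbers A, u, v such that X^4 + aX^3 + bX^2 + cX + h = (X^2 + A)(X^2 + uX + v) in ℝ[X] if and only if a^2·h + (c − a·b)·c = 0. -/
open Polynomial

/-- The monic real quartic `X^4 + aX^3 + bX^2 + cX + h` (with `a ≠ 0`) factors as
`(X^2 + A)(X^2 + uX + v)` for some real `A, u, v` iff `a^2·h + (c − a·b)·c = 0`. -/
theorem stmt_0 (a b c h : ℝ) (ha : a ≠ 0) :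
    (∃ A u v : ℝ,
        (X ^ 4 + C a * X ^ 3 + C b * X ^ 2 + C c * X + C h : ℝ[X]) =
          (X ^ 2 + C A) * (X ^ 2 + C u * X + C v)) ↔
      a ^ 2 * h + (c - a * b) * c = 0 := by
  constructor
  · rintro ⟨A, u, v, hp⟩
    have eval_eq (x : ℝ) : x ^ 4 + a * x ^ 3 + b * x ^ 2 + c * x + h =
        (x ^ 2 + A) * (x ^ 2 + u * x + v) := by
      simpa using congrArg (eval x) hp
    have h0 := eval_eq 0
    have h1 := eval_eq 1
    have h2 := eval_eq (-1)
    have h3 := eval_eq 2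
    have hu : a = u := by linarith
    have hb : b = v + A := by linarith
    have hc : c = A * u := by linarith
    have hh : h = A * v := by linarith
    subst hu hb hc hh
    ring
  · intro hΦ
    have hc : c = c / a * a := by field_simp
    have hh : h = c / a * (b - c / a) := by
      field_simp
      linear_combination hΦ
    refine ⟨c / a, a, b - c / a, ?_⟩
    generalize c / a = A at hc hh
    subst hc hh
    simp only [C_mul, C_sub]
    ring
end

section
/- The map F : ℝ^4 → ℝ^4 given by F(a,b,c,h) = (a, b, c − a·b/2, b^2/4 − h) is a bijection of ℝ^4 onto itself with inverse (a,b,ω,ϱ) ↦ (a, b, ω + a·b/2, b^2/4 − ϱ), and for every (a,b,c,h) ∈ ℝ^4 one has a^2·h + (c − a·b)·c = 0 if and only if (c − a·b/2)^2 = (b^2/4 − h)·a^2. Hence F maps the zero set of Φ(a,b,c,h) = a^2·h + (c − a·b)·c onto the set {(a,b,ω,ϱ) : ω^2 = ϱ·a^2}, which is the direct product of the b-axis ℝ with the Whitney umbrella surface ω^2 = ϱ·a^2 in ℝ^3. -/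
/-- The map `F(a,b,c,h) = (a, b, c − ab/2, b^2/4 − h)` is a bijection of `ℝ^4`
onto itself with the indicated inverse; `Φ(a,b,c,h) = a^2·h + (c − a·b)·c = 0`
iff `(c − ab/2)^2 = (b^2/4 − h)·a^2`; and `F` maps the zero set of `Φ` onto
`{(a,b,ω,ϱ) : ω^2 = ϱ·a^2}`, i.e. `ℝ` times the Whitney umbrella. -/
theorem stmt_5 :
    Function.Bijective
      (fun p : ℝ × ℝ × ℝ × ℝ =>
        (p.1, p.2.1, p.2.2.1 - p.1 * p.2.1 / 2, p.2.1 ^ 2 / 4 - p.2.2.2)) ∧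
    (∀ p : ℝ × ℝ × ℝ × ℝ,
      (fun q : ℝ × ℝ × ℝ × ℝ =>
          (q.1, q.2.1, q.2.2.1 + q.1 * q.2.1 / 2, q.2.1 ^ 2 / 4 - q.2.2.2))
        ((fun p : ℝ × ℝ × ℝ × ℝ =>
          (p.1, p.2.1, p.2.2.1 - p.1 * p.2.1 / 2, p.2.1 ^ 2 / 4 - p.2.2.2)) p) = p ∧
      (fun p : ℝ × ℝ × ℝ × ℝ =>
          (p.1, p.2.1, p.2.2.1 - p.1 * p.2.1 / 2, p.2.1 ^ 2 / 4 - p.2.2.2))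
        ((fun q : ℝ × ℝ × ℝ × ℝ =>
          (q.1, q.2.1, q.2.2.1 + q.1 * q.2.1 / 2, q.2.1 ^ 2 / 4 - q.2.2.2)) p) = p) ∧
    (∀ a b c h : ℝ,
      a ^ 2 * h + (c - a * b) * c = 0 ↔
        (c - a * b / 2) ^ 2 = (b ^ 2 / 4 - h) * a ^ 2) ∧
    (fun p : ℝ × ℝ × ℝ × ℝ =>
        (p.1, p.2.1, p.2.2.1 - p.1 * p.2.1 / 2, p.2.1 ^ 2 / 4 - p.2.2.2)) ''
      {p : ℝ × ℝ × ℝ × ℝ |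
        p.1 ^ 2 * p.2.2.2 + (p.2.2.1 - p.1 * p.2.1) * p.2.2.1 = 0} =
      {q : ℝ × ℝ × ℝ × ℝ | q.2.2.1 ^ 2 = q.2.2.2 * q.1 ^ 2} := by
  have key : ∀ a b c h : ℝ,
      a ^ 2 * h + (c - a * b) * c = 0 ↔
        (c - a * b / 2) ^ 2 = (b ^ 2 / 4 - h) * a ^ 2 := fun a b c h =>
    ⟨fun H => by linear_combination H, fun H => by linear_combination H⟩
  refine ⟨Function.bijective_iff_has_inverse.2
    ⟨fun q => (q.1, q.2.1, q.2.2.1 + q.1 * q.2.1 / 2, q.2.1 ^ 2 / 4 - q.2.2.2), ?_, ?_⟩,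
    ?_, key, ?_⟩
  · rintro ⟨a, b, c, h⟩
    simp
  · rintro ⟨a, b, w, r⟩
    simp
  · rintro ⟨a, b, c, h⟩
    simp
  · ext ⟨a, b, w, r⟩
    constructor
    · rintro ⟨⟨a, b, c, h⟩, H, ⟨⟩⟩
      exact (key a b c h).1 H
    · intro H
      refine ⟨(a, b, w + a * b / 2, b ^ 2 / 4 - r), (key _ _ _ _).2 ?_, by simp⟩
      simpa using H
end

section
/- Fix an integer d ≥ 3. Let ι : ℝ^{d−1} → ℝ^d be the map sending (c_0, c_1, …, c_{d−3}, A) to the tuple (a_0, …, a_{d−1}) of non-leading coefficients of the product (X^2 + A)·(X^{d−2} + c_{d−3}X^{d−3} + ⋯ + c_1 X + c_0) = X^d + a_{d−1}X^{d−1} + ⋯ + a_0. If A ≠ 0 and the polynomials X^2 + A and W := X^{d−2} + c_{d−3}X^{d−3} + ⋯ + c_0 are coprime in ℝ[X], then the total derivative of ι at the point (c_0, …, c_{d−3}, A) is an injective linear map from ℝ^{d−1} to ℝ^d (i.e., ι has rank d − 1 there). -/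
open Polynomial

/-- The derivative of the product map `(x, a) ↦ (P + a) * (Q + L x)`, as a linear map. -/
noncomputable def mulDeriv {E : Type*} [AddCommGroup E] [Module ℝ E] (P Q : ℝ[X])
    (L : E →ₗ[ℝ] ℝ[X]) (x : E) (a : ℝ) : E × ℝ →ₗ[ℝ] ℝ[X] :=
  LinearMap.mulLeft ℝ (P + C a) ∘ₗ L ∘ₗ LinearMap.fst ℝ E ℝ +
    (LinearMap.snd ℝ E ℝ).smulRight (Q + L x)

theorem mulDeriv_apply {E : Type*} [AddCommGroup E] [Module ℝ E] (P Q : ℝ[X])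
    (L : E →ₗ[ℝ] ℝ[X]) (x : E) (a : ℝ) (v : E × ℝ) :
    mulDeriv P Q L x a v = (P + C a) * L v.1 + C v.2 * (Q + L x) := by
  simp [mulDeriv, smul_eq_C_mul, mul_add]

theorem hasFDerivAt_apply_mul {E : Type*} [NormedAddCommGroup E] [NormedSpace ℝ E]
    [FiniteDimensional ℝ E] (φ : ℝ[X] →ₗ[ℝ] ℝ) (P Q : ℝ[X]) (L : E →ₗ[ℝ] ℝ[X])
    (x : E) (a : ℝ) :
    HasFDerivAt (fun p : E × ℝ => φ ((P + C p.2) * (Q + L p.1)))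
      (LinearMap.toContinuousLinearMap (φ ∘ₗ mulDeriv P Q L x a)) (x, a) := by
  let f : E →L[ℝ] ℝ := LinearMap.toContinuousLinearMap (φ ∘ₗ LinearMap.mulLeft ℝ P ∘ₗ L)
  let g : E →L[ℝ] ℝ := LinearMap.toContinuousLinearMap (φ ∘ₗ L)
  have hfun : (fun p : E × ℝ => φ ((P + C p.2) * (Q + L p.1))) =
      fun p => (φ (P * Q) + f p.1) + p.2 * (φ Q + g p.1) := by
    funext p
    simp [f, g, add_mul, mul_add, ← smul_eq_C_mul]
    ring
  rw [hfun]
  have hf : HasFDerivAt (fun p : E × ℝ => f p.1) (f ∘L .fst ℝ E ℝ) (x, a) :=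
    f.hasFDerivAt.comp (x, a) hasFDerivAt_fst
  have hg : HasFDerivAt (fun p : E × ℝ => g p.1) (g ∘L .fst ℝ E ℝ) (x, a) :=
    g.hasFDerivAt.comp (x, a) hasFDerivAt_fst
  refine ((hf.const_add _).add (hasFDerivAt_snd.mul (hg.const_add _))).congr_fderiv ?_
  refine ContinuousLinearMap.ext fun v => ?_
  simp [mulDeriv_apply, f, g, add_mul, mul_add, ← smul_eq_C_mul]
  ring

theorem eq_zero_of_mul_add_C_mul_eq_zero {P W V : ℝ[X]} {a : ℝ} (hP : 0 < P.degree)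
    (hcop : IsCoprime P W) (h : P * V + C a * W = 0) : a = 0 ∧ V = 0 := by
  have hdvd : P ∣ C a :=
    hcop.dvd_of_dvd_mul_right ⟨-V, by linear_combination h⟩
  have ha : a = 0 := by
    by_contra ha
    have := degree_le_of_dvd hdvd (C_ne_zero.2 ha)
    rw [degree_C ha] at this
    exact absurd hP this.not_gt
  subst ha
  have hP0 : P ≠ 0 := by rintro rfl; simp at hP
  simpa [hP0] using h

/-- For `d ≥ 3`, the map `ι` sending `(c_0, …, c_{d−3}, A)` to the non-leading
coefficients of `(X^2 + A)·(X^{d−2} + c_{d−3}X^{d−3} + ⋯ + c_0)` has injective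
total derivative (rank `d − 1`) at any point where `A ≠ 0` and `X^2 + A` is
coprime to `W = X^{d−2} + c_{d−3}X^{d−3} + ⋯ + c_0`. -/
theorem stmt_6 (d : ℕ) (hd : 3 ≤ d) (c : Fin (d - 2) → ℝ) (A : ℝ) (hA : A ≠ 0)
    (hcop : IsCoprime ((X : ℝ[X]) ^ 2 + C A)
      ((X : ℝ[X]) ^ (d - 2) + ∑ i : Fin (d - 2), C (c i) * X ^ (i : ℕ))) :
    Function.Injective
      (fderiv ℝ
        (fun p : (Fin (d - 2) → ℝ) × ℝ => fun j : Fin d =>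
          (((X : ℝ[X]) ^ 2 + C p.2) *
            ((X : ℝ[X]) ^ (d - 2) + ∑ i : Fin (d - 2), C (p.1 i) * X ^ (i : ℕ))).coeff j)
        (c, A)) := by
  revert c
  generalize hn : d - 2 = n
  obtain rfl : d = n + 2 := by omega
  intro c hcop
  let L : (Fin n → ℝ) →ₗ[ℝ] ℝ[X] := Fintype.linearCombination ℝ fun i : Fin n => X ^ (i : ℕ)
  have hL (v : Fin n → ℝ) : ∑ i : Fin n, C (v i) * X ^ (i : ℕ) = L v := by
    simp [L, Fintype.linearCombination_apply, smul_eq_C_mul]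
  have hLdeg (v : Fin n → ℝ) : (L v).degree < n := hL v ▸ degree_sum_fin_lt v
  have hLinj (v : Fin n → ℝ) (hv : L v = 0) : v = 0 := by
    funext i
    have := congrArg (fun p => p.coeff (i : ℕ)) hv
    simpa [← hL, coeff_X_pow, Fin.val_inj] using this
  simp only [hL] at hcop ⊢
  have hD := hasFDerivAt_pi.2 fun j : Fin (n + 2) =>
    hasFDerivAt_apply_mul (lcoeff ℝ (j : ℕ)) (X ^ 2) (X ^ n) L c A
  simp only [lcoeff_apply] at hD
  rw [hD.fderiv, injective_iff_map_eq_zero]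
  intro v hv
  have hdeg2 : (X ^ 2 + C A : ℝ[X]).degree = 2 := degree_X_pow_add_C two_pos A
  have hzero : (X ^ 2 + C A) * L v.1 + C v.2 * (X ^ n + L c) = 0 := by
    ext j
    by_cases hj : j < n + 2
    · simpa [mulDeriv_apply] using congrFun hv ⟨j, hj⟩
    · have hW : (C v.2 * (X ^ n + L c)).natDegree ≤ n := by
        refine (natDegree_C_mul_le _ _).trans
          (natDegree_add_le_of_degree_le (natDegree_X_pow_le n) ?_)
        exact natDegree_le_of_degree_le (hLdeg c).le
      have hP : ((X ^ 2 + C A) * L v.1).degree < ((n + 2 : ℕ) : WithBot ℕ) := by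
        rw [degree_mul, hdeg2, add_comm]
        push_cast
        exact WithBot.add_lt_add_right (by decide) (hLdeg v.1)
      rw [coeff_add, coeff_eq_zero_of_natDegree_lt (hW.trans_lt (by omega)),
        coeff_eq_zero_of_degree_lt (hP.trans_le (by exact_mod_cast not_lt.1 hj))]
      simp
  obtain ⟨h2, h1⟩ := eq_zero_of_mul_add_C_mul_eq_zero (hdeg2 ▸ by norm_num) hcop hzero
  exact Prod.ext (hLinj _ h1) h2
end

section
/- Let d and s be natural numbers with 2s ≤ d, and let t_1, …, t_s be pairwise distinct real numbers. Suppose w_1, …, w_s are nonzero vectors in ℝ^d (with coordinates indexed 1, …, d) such that for every j ∈ {1,…,s} and every index i with i + 2 ≤ d one has w_j(i+2) = t_j · w_j(i). Then the vectors w_1, …, w_s are linearly independent in ℝ^d. -/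
/-- A vector satisfying `v (i + 2) = r * v i` is geometric along each parity class. -/
theorem apply_two_mul_add_eq_pow_mul {R : Type*} [CommMonoid R] {d : ℕ} {r : R} {v : Fin d → R}
    (h : ∀ (i : Fin d) (hi : (i : ℕ) + 2 < d), v ⟨(i : ℕ) + 2, hi⟩ = r * v i)
    (e k : ℕ) (hk : 2 * k + e < d) :
    v ⟨2 * k + e, hk⟩ = r ^ k * v ⟨e, by omega⟩ := by
  induction k with
  | zero => simp
  | succ k ih =>
    have hstep := h ⟨2 * k + e, by omega⟩ (by simp only; omega)
    rw [ih, ← mul_assoc, ← pow_succ'] at hstep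
    rw [← hstep]
    congr 2
    ring

/-- Let `2s ≤ d`, let `t_1, …, t_s` be pairwise distinct reals, and let
`w_1, …, w_s` be nonzero vectors in `ℝ^d` (coordinates `0`-indexed here) such
that `w_j(i+2) = t_j · w_j(i)` whenever both indices are valid. Then the `w_j`
are linearly independent. -/
theorem stmt_7 (d s : ℕ) (hsd : 2 * s ≤ d) (t : Fin s → ℝ)
    (ht : Function.Injective t) (w : Fin s → Fin d → ℝ)
    (hw : ∀ j, w j ≠ 0)
    (hrec : ∀ (j : Fin s) (i : Fin d) (hi : (i : ℕ) + 2 < d),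
      w j ⟨(i : ℕ) + 2, hi⟩ = t j * w j i) :
    LinearIndependent ℝ w := by
  rw [Fintype.linearIndependent_iff]
  intro c hc j
  have hvanish : ∀ (e : ℕ) (he : e < 2) (hed : e < d), c j * w j ⟨e, hed⟩ = 0 := by
    intro e he hed
    refine congrFun (Matrix.eq_zero_of_forall_pow_sum_mul_pow_eq_zero
      (v := fun j => c j * w j ⟨e, hed⟩) ht fun k => ?_) j
    have hcoord := congrFun hc ⟨2 * k + e, by omega⟩
    simp only [Finset.sum_apply, Pi.smul_apply, smul_eq_mul, Pi.zero_apply] at hcoord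
    rw [← hcoord]
    refine Finset.sum_congr rfl fun i _ => ?_
    rw [apply_two_mul_add_eq_pow_mul (hrec i)]
    ring
  by_contra hcj
  refine hw j (funext fun i => ?_)
  have hi : i = ⟨2 * (i / 2 : ℕ) + i % 2, by omega⟩ := Fin.ext (Nat.div_add_mod _ _).symm
  rw [hi, apply_two_mul_add_eq_pow_mul (hrec j),
    (mul_eq_zero.mp (hvanish _ (Nat.mod_lt _ two_pos) _)).resolve_left hcj, mul_zero,
    Pi.zero_apply]
end

section
/- For real numbers u, w, the quartic Q = (X^2 − u^2)(X^2 + X + w) has a multiple root in ℂ (i.e., there exists z ∈ ℂ with Q(z) = 0 and Q′(z) = 0) if and only if u = 0, or u^2 + u + w = 0, or u^2 − u + w = 0, or w = 1/4. -/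
open Polynomial

/-- The quartic `Q = (X^2 − u^2)(X^2 + X + w)` has a multiple root in `ℂ`
(a `z` with `Q(z) = Q′(z) = 0`) iff `u = 0`, or `u^2 + u + w = 0`, or
`u^2 − u + w = 0`, or `w = 1/4`. -/
theorem stmt_12 (u w : ℝ) :
    (∃ z : ℂ,
        aeval z ((X ^ 2 - C (u ^ 2)) * (X ^ 2 + X + C w) : ℝ[X]) = 0 ∧
        aeval z (derivative ((X ^ 2 - C (u ^ 2)) * (X ^ 2 + X + C w) : ℝ[X])) = 0) ↔
      u = 0 ∨ u ^ 2 + u + w = 0 ∨ u ^ 2 - u + w = 0 ∨ w = 1 / 4 := by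
  simp only [derivative_mul, derivative_pow, derivative_X, derivative_C, map_mul, map_sub, map_add,
    map_pow, map_one, aeval_X, aeval_C, Complex.coe_algebraMap, Nat.cast_ofNat,
    Nat.add_one_sub_one, pow_one, mul_one, mul_zero, sub_zero, add_zero, Complex.ofReal_ofNat]
  constructor
  · rintro ⟨z, hQ, hQ'⟩
    have root_of_common (ha : z ^ 2 - (u : ℂ) ^ 2 = 0) (hb : z ^ 2 + z + w = 0) :
        u ^ 2 + u + w = 0 ∨ u ^ 2 - u + w = 0 := by
      rcases sq_eq_sq_iff_eq_or_eq_neg.mp (sub_eq_zero.mp ha) with rfl | rfl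
      · left; exact_mod_cast hb
      · right
        have h : (u : ℂ) ^ 2 - u + w = 0 := by linear_combination hb
        exact_mod_cast h
    rcases mul_eq_zero.mp hQ with ha | hb
    · have h : z * (z ^ 2 + z + w) = 0 := by
        linear_combination hQ' / 2 - (2 * z + 1) / 2 * ha
      rcases mul_eq_zero.mp h with rfl | hb
      · left
        have hu : (u : ℂ) ^ 2 = 0 := by linear_combination -ha
        exact_mod_cast pow_eq_zero_iff two_ne_zero |>.mp hu
      · have := root_of_common ha hb
        tauto
    · have h : (z ^ 2 - (u : ℂ) ^ 2) * (2 * z + 1) = 0 := by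
        linear_combination hQ' - 2 * z * hb
      rcases mul_eq_zero.mp h with ha | hz
      · have := root_of_common ha hb
        tauto
      · right; right; right
        have hw : (w : ℂ) = ((1 / 4 : ℝ) : ℂ) := by
          push_cast
          linear_combination hb - (2 * z + 1) / 4 * hz
        exact_mod_cast hw
  · rintro (rfl | h | h | rfl)
    · exact ⟨0, by simp, by simp⟩
    · have h' : (u : ℂ) ^ 2 + u + w = 0 := by exact_mod_cast h
      refine ⟨u, by simp, ?_⟩
      linear_combination 2 * (u : ℂ) * h'
    · have h' : (u : ℂ) ^ 2 - u + w = 0 := by exact_mod_cast h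
      refine ⟨-u, by simp, ?_⟩
      linear_combination -2 * (u : ℂ) * h'
    · refine ⟨-1 / 2, ?_, ?_⟩ <;> push_cast <;> ring
end

section
/- For real numbers b, c, there exist real numbers u, w with b = w − u^2, c = −u^2 and (u^2 + u + w)·(u^2 − u + w) = 0, if and only if (b − 2c)^2 + c = 0. -/
/-- There exist real `u, w` with `b = w − u^2`, `c = −u^2` and
`(u^2 + u + w)·(u^2 − u + w) = 0` iff `(b − 2c)^2 + c = 0`. -/
theorem stmt_13 (b c : ℝ) :
    (∃ u w : ℝ, b = w - u ^ 2 ∧ c = -u ^ 2 ∧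
        (u ^ 2 + u + w) * (u ^ 2 - u + w) = 0) ↔
      (b - 2 * c) ^ 2 + c = 0 := by
  constructor
  · rintro ⟨u, w, rfl, rfl, h⟩
    linear_combination h
  · intro h
    exact ⟨b - 2 * c, b - c, by linear_combination h, by linear_combination h,
      by linear_combination ((b - 2 * c) ^ 2 + 2 * b - 3 * c) * h⟩
end

section
/- If ζ, θ are real numbers and (X − ζ)^2·(X − θ)^2 = X^4 + X^3 + bX^2 + cX + h in ℝ[X], then ζ + θ = −1/2, c = b/2 − 1/8 and h = c^2. -/
open Polynomial

/-- If `(X − ζ)^2·(X − θ)^2 = X^4 + X^3 + bX^2 + cX + h` in `ℝ[X]`, then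
`ζ + θ = −1/2`, `c = b/2 − 1/8` and `h = c^2`. -/
theorem stmt_14 (ζ θ b c h : ℝ)
    (heq : ((X - C ζ) ^ 2 * (X - C θ) ^ 2 : ℝ[X]) =
      X ^ 4 + X ^ 3 + C b * X ^ 2 + C c * X + C h) :
    ζ + θ = -(1 / 2) ∧ c = b / 2 - 1 / 8 ∧ h = c ^ 2 := by
  have ev (x : ℝ) : (x - ζ) ^ 2 * (x - θ) ^ 2 = x ^ 4 + x ^ 3 + b * x ^ 2 + c * x + h := by
    simpa using congrArg (eval x) heq
  have h₀ := ev 0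
  have h₁ := ev 1
  have h₂ := ev (-1)
  have h₃ := ev 2
  have h₄ := ev (-2)
  have hs : ζ + θ = -(1 / 2) := by linarith
  have hb : b = (ζ + θ) ^ 2 + 2 * (ζ * θ) := by linarith
  have hc : c = -2 * (ζ * θ) * (ζ + θ) := by linarith
  have hh : h = (ζ * θ) ^ 2 := by linarith
  rw [hs] at hb hc
  refine ⟨hs, by linarith, ?_⟩
  rw [hh, hc]
  ring
end

section
/- Let α_1, γ_1, α_2, γ_2 be real numbers with 0 < α_1 < γ_1 < α_2 < γ_2, and write (X − α_1)(X − α_2)(X + γ_1)(X + γ_2) = X^4 + aX^3 + bX^2 + cX + h. Then a > 0, b < 0, c < 0 and h > 0. -/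
open Polynomial

/-- If `0 < α_1 < γ_1 < α_2 < γ_2` and
`(X − α_1)(X − α_2)(X + γ_1)(X + γ_2) = X^4 + aX^3 + bX^2 + cX + h`, then
`a > 0`, `b < 0`, `c < 0` and `h > 0` (rigidity of the moduli order
`P < N < P < N`). -/
theorem stmt_16 (α₁ γ₁ α₂ γ₂ a b c h : ℝ)
    (h1 : 0 < α₁) (h2 : α₁ < γ₁) (h3 : γ₁ < α₂) (h4 : α₂ < γ₂)
    (heq : ((X - C α₁) * (X - C α₂) * (X + C γ₁) * (X + C γ₂) : ℝ[X]) =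
      X ^ 4 + C a * X ^ 3 + C b * X ^ 2 + C c * X + C h) :
    0 < a ∧ b < 0 ∧ c < 0 ∧ 0 < h := by
  have eval_eq (t : ℝ) : (t - α₁) * (t - α₂) * (t + γ₁) * (t + γ₂) =
      t ^ 4 + a * t ^ 3 + b * t ^ 2 + c * t + h := by
    simpa using congrArg (eval t) heq
  have e0 := eval_eq 0
  have e1 := eval_eq 1
  have e2 := eval_eq (-1)
  have e3 := eval_eq 2
  have ha : a = (γ₁ - α₁) + (γ₂ - α₂) := by linarith
  have hb : b = -(γ₂ * (α₂ - γ₁) + α₂ * (γ₁ - α₁) + α₁ * (γ₁ + γ₂)) := by linarith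
  have hc : c = -(α₂ * γ₂ * (γ₁ - α₁) + α₁ * γ₁ * (γ₂ - α₂)) := by linarith
  have hh : h = α₁ * α₂ * γ₁ * γ₂ := by linarith
  have hγ₁ : 0 < γ₁ := h1.trans h2
  have hα₂ : 0 < α₂ := hγ₁.trans h3
  have hγ₂ : 0 < γ₂ := hα₂.trans h4
  have d1 : 0 < γ₁ - α₁ := sub_pos.2 h2
  have d2 : 0 < α₂ - γ₁ := sub_pos.2 h3
  have d3 : 0 < γ₂ - α₂ := sub_pos.2 h4
  rw [ha, hb, hc, hh, neg_lt_zero, neg_lt_zero]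
  refine ⟨?_, ?_, ?_, ?_⟩ <;> positivity
end
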